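/- arXiv:2004.09079 — 4 statements merged into one kernel-verified Lean document; each statement's English description precedes it below -/
import Mathlib

section
/- Let μ be a probability distribution on the k-element subsets of [n] whose generating polynomial g_μ is log-concave. Then for every k-element subset T ⊆ [n], μ(T) ≤ ∏_{i∈T} P_{S∼μ}[i ∈ S]. -/
open Finset

/-- A probability distribution on the `k`-element subsets of `[n]`:
nonnegative, supported on `k`-element sets, summing to `1`. -/
def IsProbDistOn (n k : ℕ) (μ : Finset (Fin n) → ℝ) : Prop :=
  (∀ S, 0 ≤ μ S) ∧ (∀ S, S.card ≠ k → μ S = 0) ∧ (∑ S : Finset (Fin n), μ S = 1)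

/-- The generating polynomial `g_μ(z) = ∑_{|S|=k} μ(S) ∏_{i∈S} z_i`. -/
noncomputable def genPoly (n k : ℕ) (μ : Finset (Fin n) → ℝ) (z : Fin n → ℝ) : ℝ :=
  ∑ S ∈ Finset.univ.filter (fun S : Finset (Fin n) => S.card = k), μ S * ∏ i ∈ S, z i

/-- `g` is log-concave as a function on `ℝ_{≥0}^n`. -/
def IsLogConcaveOn (n : ℕ) (g : (Fin n → ℝ) → ℝ) : Prop :=
  ∀ x y : Fin n → ℝ, (∀ i, 0 ≤ x i) → (∀ i, 0 ≤ y i) →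
    ∀ lam : ℝ, 0 < lam → lam < 1 →
      g x ^ lam * g y ^ (1 - lam) ≤ g (fun i => lam * x i + (1 - lam) * y i)

/-- The marginal `P_{S∼μ}[i ∈ S]`. -/
noncomputable def marginal (n : ℕ) (μ : Finset (Fin n) → ℝ) (i : Fin n) : ℝ :=
  ∑ S ∈ Finset.univ.filter (fun S : Finset (Fin n) => i ∈ S), μ S

open Filter Topology in
/-- A function that vanishes at `0` and is nonnegative on `(0, 1)` has nonnegative derivative
at `0`. -/
theorem HasDerivAt.nonneg_of_nonneg_Ioo {h : ℝ → ℝ} {d : ℝ} (hd : HasDerivAt h d 0)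
    (h0 : h 0 = 0) (hpos : ∀ t, 0 < t → t < 1 → 0 ≤ h t) : 0 ≤ d := by
  refine ge_of_tendsto hd.tendsto_slope_zero_right ?_
  filter_upwards [Ioo_mem_nhdsGT (zero_lt_one (α := ℝ))] with t ht
  simpa [h0] using mul_nonneg (inv_nonneg.2 ht.1.le) (hpos t ht.1 ht.2)

theorem sum_filter_card_mul_eq_sum {n k : ℕ} {μ : Finset (Fin n) → ℝ}
    (hμ : ∀ S, S.card ≠ k → μ S = 0) (F : Finset (Fin n) → ℝ) :
    ∑ S ∈ Finset.univ.filter (fun S : Finset (Fin n) => S.card = k), μ S * F S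
      = ∑ S, μ S * F S := by
  refine Finset.sum_subset (Finset.subset_univ _) fun S _ hS => ?_
  rw [hμ S (by simpa using hS), zero_mul]

theorem sum_marginal_mul (n : ℕ) (μ : Finset (Fin n) → ℝ) (w : Fin n → ℝ) :
    ∑ i, marginal n μ i * w i = ∑ S, μ S * ∑ i ∈ S, w i := by
  simp only [marginal, Finset.sum_mul, Finset.mul_sum, Finset.sum_filter]
  rw [Finset.sum_comm]
  refine Finset.sum_congr rfl fun S _ => ?_
  simp [ite_mul]

theorem sum_marginal {n k : ℕ} {μ : Finset (Fin n) → ℝ} (hμ : IsProbDistOn n k μ) :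
    ∑ i, marginal n μ i = k := by
  have h := sum_marginal_mul n μ 1
  simp only [Pi.one_apply, mul_one, Finset.sum_const, nsmul_eq_mul] at h
  rw [h, ← one_mul (k : ℝ), ← hμ.2.2, Finset.sum_mul, ← sum_filter_card_mul_eq_sum hμ.2.1,
    ← sum_filter_card_mul_eq_sum hμ.2.1 fun _ => (k : ℝ)]
  refine Finset.sum_congr rfl fun S hS => ?_
  rw [(Finset.mem_filter.1 hS).2]

theorem genPoly_one {n k : ℕ} {μ : Finset (Fin n) → ℝ} (hμ : IsProbDistOn n k μ) :
    genPoly n k μ (fun _ => 1) = 1 := by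
  rw [genPoly, sum_filter_card_mul_eq_sum hμ.2.1]
  simpa using hμ.2.2

theorem hasDerivAt_genPoly_segment {n k : ℕ} {μ : Finset (Fin n) → ℝ}
    (hμ : IsProbDistOn n k μ) (z : Fin n → ℝ) :
    HasDerivAt (fun t : ℝ => genPoly n k μ (fun i => t * z i + (1 - t) * 1))
      (∑ i, marginal n μ i * (z i - 1)) 0 := by
  rw [sum_marginal_mul, ← sum_filter_card_mul_eq_sum hμ.2.1]
  refine HasDerivAt.fun_sum fun S _ => HasDerivAt.const_mul _ ?_
  have hi (i : Fin n) : HasDerivAt (fun t : ℝ => t * z i + (1 - t) * 1) (z i - 1) 0 := by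
    have h := ((hasDerivAt_id (0 : ℝ)).mul_const (z i)).add
      (((hasDerivAt_id (0 : ℝ)).const_sub 1).mul_const 1)
    convert! h using 1
    ring
  convert! HasDerivAt.fun_finsetProd (u := S) (fun i _ => hi i) using 1
  simp

/-- The tangent inequality at the all-ones point for a log-concave generating polynomial. -/
theorem log_genPoly_le {n k : ℕ} {μ : Finset (Fin n) → ℝ} (hμ : IsProbDistOn n k μ)
    (hlc : IsLogConcaveOn n (genPoly n k μ)) {z : Fin n → ℝ} (hz : ∀ i, 0 ≤ z i)
    (hpos : 0 < genPoly n k μ z) :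
    Real.log (genPoly n k μ z) ≤ ∑ i, marginal n μ i * (z i - 1) := by
  have hpow : HasDerivAt (fun t : ℝ => genPoly n k μ z ^ t) (Real.log (genPoly n k μ z)) 0 := by
    simpa using (Real.hasStrictDerivAt_const_rpow hpos 0).hasDerivAt
  refine sub_nonneg.1 <|
    ((hasDerivAt_genPoly_segment hμ z).sub hpow).nonneg_of_nonneg_Ioo ?_ fun t h0 h1 => ?_
  · simp [genPoly_one hμ]
  · have h := hlc z (fun _ => 1) hz (fun _ => zero_le_one) t h0 h1
    rw [genPoly_one hμ, Real.one_rpow, mul_one] at h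
    exact sub_nonneg.2 h

theorem genPoly_eq_of_support {n k : ℕ} (μ : Finset (Fin n) → ℝ) {T : Finset (Fin n)}
    (hT : T.card = k) {z : Fin n → ℝ} (hz : ∀ i ∉ T, z i = 0) :
    genPoly n k μ z = μ T * ∏ i ∈ T, z i := by
  refine Finset.sum_eq_single_of_mem T (by simpa using hT) fun S hS hST => ?_
  have hcard : S.card = k := (Finset.mem_filter.1 hS).2
  obtain ⟨i, hiS, hiT⟩ := Finset.not_subset.1 fun h =>
    hST (Finset.eq_of_subset_of_card_le h (by rw [hT, hcard]))
  rw [Finset.prod_eq_zero hiS (hz i hiT), mul_zero]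

theorem le_marginal {n : ℕ} {μ : Finset (Fin n) → ℝ} (hμ : ∀ S, 0 ≤ μ S)
    {T : Finset (Fin n)} {i : Fin n} (hi : i ∈ T) : μ T ≤ marginal n μ i :=
  Finset.single_le_sum (f := μ) (fun S _ => hμ S) (by simpa using hi)

theorem negative_correlation_pointwise
    (n k : ℕ) (hk : 1 ≤ k) (hkn : k ≤ n)
    (μ : Finset (Fin n) → ℝ) (hμ : IsProbDistOn n k μ)
    (hlc : IsLogConcaveOn n (genPoly n k μ))
    (T : Finset (Fin n)) (hT : T.card = k) :
    μ T ≤ ∏ i ∈ T, marginal n μ i := by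
  have hm (i : Fin n) : 0 ≤ marginal n μ i := Finset.sum_nonneg fun S _ => hμ.1 S
  rcases (hμ.1 T).eq_or_lt with h0 | hTpos
  · rw [← h0]
    exact Finset.prod_nonneg fun i _ => hm i
  have hmT : ∀ i ∈ T, 0 < marginal n μ i := fun i hi => hTpos.trans_le (le_marginal hμ.1 hi)
  have hprod : 0 < ∏ i ∈ T, marginal n μ i := Finset.prod_pos hmT
  let z : Fin n → ℝ := fun i => if i ∈ T then (marginal n μ i)⁻¹ else 0
  have hz (i : Fin n) : 0 ≤ z i := by
    by_cases hi : i ∈ T <;> simp [z, hi, hm i]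
  have hg : genPoly n k μ z = μ T / ∏ i ∈ T, marginal n μ i := by
    rw [genPoly_eq_of_support μ hT (fun i hi => if_neg hi), div_eq_mul_inv,
      ← Finset.prod_inv_distrib]
    exact congrArg _ (Finset.prod_congr rfl fun i hi => if_pos hi)
  have hgpos : 0 < genPoly n k μ z := hg ▸ div_pos hTpos hprod
  have hsum : ∑ i, marginal n μ i * (z i - 1) = 0 := by
    have h1 : ∑ i, marginal n μ i * z i = k := by
      have h2 : ∀ i, marginal n μ i * z i = if i ∈ T then 1 else 0 := fun i => by
        by_cases hi : i ∈ T
        · simp [z, hi, (hmT i hi).ne']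
        · simp [z, hi]
      simp [h2, hT]
    simp only [mul_sub, mul_one, Finset.sum_sub_distrib, h1, sum_marginal hμ, sub_self]
  have hlog := log_genPoly_le hμ hlc hz hgpos
  rw [hsum, Real.log_nonpos_iff hgpos.le, hg, div_le_one hprod] at hlog
  exact hlog
end

section
/- Let μ be a probability distribution on the k-element subsets of [n] whose generating polynomial g_μ is log-concave. Then for every subset T ⊆ [n] of size l with 1 ≤ l ≤ k, P_{S∼μ}[T ⊆ S] ≤ binom(k,l) · (l/k)^l · ∏_{i∈T} P_{S∼μ}[i ∈ S], where P_{S∼μ}[T ⊆ S] = ∑_{S ⊇ T} μ(S). -/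
open Finset

/-- The distribution of `S \ {i}` for `S ∼ μ` conditioned on `i ∈ S`. -/
noncomputable def condDist (n : ℕ) (μ : Finset (Fin n) → ℝ) (i : Fin n) (S : Finset (Fin n)) : ℝ :=
  if i ∈ S then 0 else μ (insert i S) / marginal n μ i

theorem marginal_nonneg {n : ℕ} {μ : Finset (Fin n) → ℝ} (h0 : ∀ S, 0 ≤ μ S) (i : Fin n) :
    0 ≤ marginal n μ i :=
  Finset.sum_nonneg fun S _ => h0 S

theorem sum_mul_condDist {n : ℕ} {μ : Finset (Fin n) → ℝ} {i : Fin n}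
    (hi : marginal n μ i ≠ 0) (F : Finset (Fin n) → ℝ) :
    marginal n μ i * ∑ S, condDist n μ i S * F S =
      ∑ S ∈ univ.filter (fun S : Finset (Fin n) => i ∈ S), μ S * F (S.erase i) := by
  have h1 : ∑ S, condDist n μ i S * F S =
      ∑ S ∈ univ.filter (fun S : Finset (Fin n) => i ∉ S),
        μ (insert i S) / marginal n μ i * F S := by
    rw [Finset.sum_filter]
    refine Finset.sum_congr rfl fun S _ => ?_
    by_cases h : i ∈ S <;> simp [condDist, h]
  rw [h1, Finset.mul_sum]
  refine Finset.sum_nbij' (fun S => insert i S) (fun S => S.erase i) ?_ ?_ ?_ ?_ ?_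
  · intro S _
    simp
  · intro S _
    simp
  · intro S hS
    exact Finset.erase_insert (by simpa using hS)
  · intro S hS
    exact Finset.insert_erase (by simpa using hS)
  · intro S hS
    have hS' : i ∉ S := by simpa using hS
    rw [Finset.erase_insert hS']
    field_simp

theorem isProbDistOn_condDist {n k : ℕ} {μ : Finset (Fin n) → ℝ} {i : Fin n}
    (hμ : IsProbDistOn n (k + 1) μ) (hi : marginal n μ i ≠ 0) :
    IsProbDistOn n k (condDist n μ i) := by
  refine ⟨fun S => ?_, fun S hS => ?_, ?_⟩
  · unfold condDist
    split_ifs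
    · exact le_rfl
    · exact div_nonneg (hμ.1 _) (marginal_nonneg hμ.1 i)
  · unfold condDist
    split_ifs with h
    · rfl
    · rw [hμ.2.1 _ (by rw [Finset.card_insert_of_notMem h]; omega), zero_div]
  · have h := sum_mul_condDist hi fun _ => 1
    simp only [mul_one] at h
    exact mul_left_cancel₀ hi (h.trans (mul_one _).symm)

theorem genPoly_eq_sum {n k : ℕ} {μ : Finset (Fin n) → ℝ} (hμ : IsProbDistOn n k μ)
    (z : Fin n → ℝ) : genPoly n k μ z = ∑ S, μ S * ∏ i ∈ S, z i := by
  unfold genPoly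
  rw [Finset.sum_filter]
  refine Finset.sum_congr rfl fun S _ => ?_
  split_ifs with h
  · rfl
  · rw [hμ.2.1 S h, zero_mul]

theorem genPoly_nonneg {n k : ℕ} {μ : Finset (Fin n) → ℝ} (h0 : ∀ S, 0 ≤ μ S)
    {z : Fin n → ℝ} (hz : ∀ i, 0 ≤ z i) : 0 ≤ genPoly n k μ z :=
  Finset.sum_nonneg fun S _ => mul_nonneg (h0 S) (Finset.prod_nonneg fun i _ => hz i)

theorem genPoly_update {n k : ℕ} {μ : Finset (Fin n) → ℝ} {i : Fin n}
    (hμ : IsProbDistOn n (k + 1) μ) (hi : marginal n μ i ≠ 0) (z : Fin n → ℝ) (s : ℝ) :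
    genPoly n (k + 1) μ (Function.update z i s) =
      s * (marginal n μ i * genPoly n k (condDist n μ i) z) +
        ∑ S ∈ univ.filter (fun S : Finset (Fin n) => i ∉ S), μ S * ∏ j ∈ S, z j := by
  rw [genPoly_eq_sum hμ, genPoly_eq_sum (isProbDistOn_condDist hμ hi), sum_mul_condDist hi,
    ← Finset.sum_filter_add_sum_filter_not univ (fun S : Finset (Fin n) => i ∈ S), Finset.mul_sum]
  congr 1
  · refine Finset.sum_congr rfl fun S hS => ?_
    have hS' : i ∈ S := by simpa using hS
    rw [← Finset.mul_prod_erase S _ hS', Function.update_self,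
      Finset.prod_congr rfl fun j hj => Function.update_of_ne (Finset.ne_of_mem_erase hj) s z]
    ring
  · refine Finset.sum_congr rfl fun S hS => ?_
    have hS' : i ∉ S := by simpa using hS
    rw [Finset.prod_congr rfl fun j hj =>
      Function.update_of_ne (show j ≠ i from fun h => hS' (h ▸ hj)) s z]

theorem isLogConcaveOn_condDist {n k : ℕ} {μ : Finset (Fin n) → ℝ} {i : Fin n}
    (hμ : IsProbDistOn n (k + 1) μ) (hlc : IsLogConcaveOn n (genPoly n (k + 1) μ))
    (hi : marginal n μ i ≠ 0) : IsLogConcaveOn n (genPoly n k (condDist n μ i)) := by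
  intro x y hx hy a ha ha1
  have hc := isProbDistOn_condDist hμ hi
  have hp : 0 < marginal n μ i := (marginal_nonneg hμ.1 i).lt_of_ne' hi
  set p := marginal n μ i
  set z : Fin n → ℝ := fun j => a * x j + (1 - a) * y j
  have hrest : ∀ u : Fin n → ℝ, (∀ j, 0 ≤ u j) →
      0 ≤ ∑ S ∈ univ.filter (fun S : Finset (Fin n) => i ∉ S), μ S * ∏ j ∈ S, u j :=
    fun u hu => Finset.sum_nonneg fun S _ =>
      mul_nonneg (hμ.1 S) (Finset.prod_nonneg fun j _ => hu j)
  have hz : ∀ j, 0 ≤ z j := fun j =>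
    add_nonneg (mul_nonneg ha.le (hx j)) (mul_nonneg (by linarith) (hy j))
  set B := ∑ S ∈ univ.filter (fun S : Finset (Fin n) => i ∉ S), μ S * ∏ j ∈ S, z j
  have hB : 0 ≤ B := hrest z hz
  set Ax := genPoly n k (condDist n μ i) x
  set Ay := genPoly n k (condDist n μ i) y
  set Az := genPoly n k (condDist n μ i) z
  have hAx : 0 ≤ Ax := genPoly_nonneg hc.1 hx
  have hAy : 0 ≤ Ay := genPoly_nonneg hc.1 hy
  have key : ∀ s : ℝ, 0 < s → s * p * (Ax ^ a * Ay ^ (1 - a)) ≤ s * (p * Az) + B := by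
    intro s hs
    have hu : ∀ u : Fin n → ℝ, (∀ j, 0 ≤ u j) → ∀ j, 0 ≤ Function.update u i s j := by
      intro u hu j
      by_cases h : j = i
      · subst h
        simpa using hs.le
      · simpa [h] using hu j
    have h := hlc _ _ (hu x hx) (hu y hy) a ha ha1
    have hzs : (fun j => a * Function.update x i s j + (1 - a) * Function.update y i s j) =
        Function.update z i s := by
      funext j
      by_cases h : j = i
      · subst h
        simp
        ring
      · simp [h, z]
    rw [hzs, genPoly_update hμ hi, genPoly_update hμ hi, genPoly_update hμ hi] at h
    refine le_trans ?_ h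
    have hsp : 0 < s * p := mul_pos hs hp
    calc s * p * (Ax ^ a * Ay ^ (1 - a))
        = (s * p * Ax) ^ a * (s * p * Ay) ^ (1 - a) := by
          rw [Real.mul_rpow hsp.le hAx, Real.mul_rpow hsp.le hAy]
          have : (s * p) ^ a * (s * p) ^ (1 - a) = s * p := by
            rw [← Real.rpow_add hsp]
            simp
          linear_combination -(Ax ^ a * Ay ^ (1 - a)) * this
      _ ≤ _ := by
          have h1 : 0 ≤ s * p * Ax := mul_nonneg hsp.le hAx
          have h2 : 0 ≤ s * p * Ay := mul_nonneg hsp.le hAy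
          have h3 : 0 ≤ 1 - a := by linarith
          have hx' : s * p * Ax ≤ s * (p * Ax) +
              ∑ S ∈ univ.filter (fun S : Finset (Fin n) => i ∉ S), μ S * ∏ j ∈ S, x j := by
            linarith [hrest x hx]
          have hy' : s * p * Ay ≤ s * (p * Ay) +
              ∑ S ∈ univ.filter (fun S : Finset (Fin n) => i ∉ S), μ S * ∏ j ∈ S, y j := by
            linarith [hrest y hy]
          exact mul_le_mul (Real.rpow_le_rpow h1 hx' ha.le) (Real.rpow_le_rpow h2 hy' h3)
            (Real.rpow_nonneg h2 _) (Real.rpow_nonneg (h1.trans hx') _)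
  refine le_of_forall_pos_le_add fun ε hε => ?_
  have hs : 0 < (B + 1) / (p * ε) := by positivity
  have h := key _ hs
  have h1 : (B + 1) / (p * ε) * (p * ε) = B + 1 := div_mul_cancel₀ _ (by positivity)
  have h2 : (B + 1) / (p * ε) * p * (Ax ^ a * Ay ^ (1 - a)) ≤
      (B + 1) / (p * ε) * p * (Az + ε) := by linarith
  exact le_of_mul_le_mul_left h2 (mul_pos hs hp)

theorem exists_prod_one_add_mul_eq {ι : Type*} [DecidableEq ι] (S : Finset ι) (w : ι → ℝ) :
    ∃ R : ℝ → ℝ, Continuous R ∧ ∀ t, ∏ i ∈ S, (1 + t * w i) =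
      1 + t * ∑ i ∈ S, w i + t ^ 2 * (((∑ i ∈ S, w i) ^ 2 - ∑ i ∈ S, w i ^ 2) / 2) +
        t ^ 3 * R t := by
  induction S using Finset.induction_on with
  | empty => exact ⟨fun _ => 0, continuous_const, by simp⟩
  | insert a S ha ih =>
    obtain ⟨R, hR, h⟩ := ih
    refine ⟨fun t => R t + w a * (((∑ i ∈ S, w i) ^ 2 - ∑ i ∈ S, w i ^ 2) / 2) + t * w a * R t,
      by fun_prop, fun t => ?_⟩
    rw [Finset.prod_insert ha, Finset.sum_insert ha, Finset.sum_insert ha, h]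
    ring

theorem nonpos_of_eventually_add_mul_nonpos {c : ℝ} {R : ℝ → ℝ} (hR : Continuous R)
    (h : ∀ᶠ t in nhdsWithin (0 : ℝ) (Set.Ioi 0), c + t * R t ≤ 0) : c ≤ 0 := by
  have h1 : Filter.Tendsto (fun t => c + t * R t) (nhdsWithin (0 : ℝ) (Set.Ioi 0)) (nhds c) := by
    have h2 : Continuous fun t => c + t * R t := by fun_prop
    have h3 := h2.tendsto 0
    simp only [zero_mul, add_zero] at h3
    exact h3.mono_left nhdsWithin_le_nhds
  exact le_of_tendsto h1 h

theorem sum_mul_sq_sub_le {n k : ℕ} {μ : Finset (Fin n) → ℝ}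
    (hμ : IsProbDistOn n k μ) (hlc : IsLogConcaveOn n (genPoly n k μ)) (w : Fin n → ℝ) :
    ∑ S, μ S * ((∑ i ∈ S, w i) ^ 2 - ∑ i ∈ S, w i ^ 2) ≤ (∑ S, μ S * ∑ i ∈ S, w i) ^ 2 := by
  choose R hR h using fun S : Finset (Fin n) => exists_prod_one_add_mul_eq S w
  set A := ∑ S, μ S * ∑ i ∈ S, w i
  set Q := ∑ S, μ S * ((∑ i ∈ S, w i) ^ 2 - ∑ i ∈ S, w i ^ 2)
  have hg : ∀ t : ℝ, genPoly n k μ (fun i => 1 + t * w i) =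
      1 + t * A + t ^ 2 * (Q / 2) + t ^ 3 * ∑ S, μ S * R S t := by
    intro t
    rw [genPoly_eq_sum hμ]
    simp only [h]
    nth_rw 2 [← hμ.2.2]
    rw [Finset.mul_sum, Finset.sum_div, Finset.mul_sum, Finset.mul_sum, ← Finset.sum_add_distrib,
      ← Finset.sum_add_distrib, ← Finset.sum_add_distrib]
    refine Finset.sum_congr rfl fun S _ => ?_
    ring
  have hRc : Continuous fun t => ∑ S, μ S * R S t :=
    continuous_finsetSum _ fun S _ => (hR S).const_mul (μ S)
  set r : ℝ → ℝ := fun t => ∑ S, μ S * R S t with hr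
  refine sub_nonpos.1 (nonpos_of_eventually_add_mul_nonpos (c := Q - A ^ 2)
    (R := fun t => t * (Q / 2) ^ 2 + (1 - t * A + t ^ 2 * (Q / 2)) * r t
      - (1 + t * A + t ^ 2 * (Q / 2)) * r (-t) - t ^ 3 * r t * r (-t)) (by fun_prop) ?_)
  have hsmall : ∀ᶠ t in nhdsWithin (0 : ℝ) (Set.Ioi 0),
      ∀ i, 0 < 1 + t * w i ∧ 0 < 1 + -t * w i := by
    refine Filter.eventually_all.2 fun i => ?_
    have h1 : Continuous fun t : ℝ => 1 + t * w i := by fun_prop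
    have h2 : Continuous fun t : ℝ => 1 + -t * w i := by fun_prop
    exact ((h1.continuousAt.eventually_const_lt (u := 0) (by simp)).and
      (h2.continuousAt.eventually_const_lt (u := 0) (by simp))).filter_mono nhdsWithin_le_nhds
  filter_upwards [hsmall, self_mem_nhdsWithin] with t ht ht0
  have ht0 : 0 < t := ht0
  have hle := hlc _ _ (fun i => (ht i).1.le) (fun i => (ht i).2.le) (1 / 2) (by norm_num)
    (by norm_num)
  have hone : genPoly n k μ
      (fun i => 1 / 2 * (1 + t * w i) + (1 - 1 / 2) * (1 + -t * w i)) = 1 := by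
    rw [genPoly_eq_sum hμ]
    refine (Finset.sum_congr rfl fun S _ => ?_).trans hμ.2.2
    rw [Finset.prod_eq_one fun i _ => by ring, mul_one]
  rw [hone, show (1 : ℝ) - 1 / 2 = 1 / 2 by norm_num,
    ← Real.mul_rpow (genPoly_nonneg hμ.1 fun i => (ht i).1.le)
      (genPoly_nonneg hμ.1 fun i => (ht i).2.le), ← Real.sqrt_eq_rpow, Real.sqrt_le_iff,
    hg, hg] at hle
  replace hle := hle.2
  have hfac : 0 < t ^ 2 := by positivity
  refine nonpos_of_mul_nonpos_right (a := t ^ 2) ?_ hfac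
  simp only [hr]
  linarith

theorem sum_mul_sq_sub_le_of_homogeneous {n k : ℕ} (hk : 1 ≤ k) {μ : Finset (Fin n) → ℝ}
    (hμ : IsProbDistOn n k μ) (hlc : IsLogConcaveOn n (genPoly n k μ)) (v : Fin n → ℝ) :
    ∑ S, μ S * ((∑ i ∈ S, v i) ^ 2 - ∑ i ∈ S, v i ^ 2) ≤
      (1 - 1 / (k : ℝ)) * (∑ S, μ S * ∑ i ∈ S, v i) ^ 2 := by
  have hk' : (k : ℝ) ≠ 0 := by positivity
  set m := ∑ S, μ S * ∑ i ∈ S, v i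
  set c := m / k with hc
  have hck : c * k = m := div_mul_cancel₀ _ hk'
  have h := sum_mul_sq_sub_le hμ hlc fun i => v i - c
  have h1 : ∑ S, μ S * ∑ i ∈ S, (v i - c) = 0 := by
    have : ∀ S, μ S * ∑ i ∈ S, (v i - c) = μ S * ∑ i ∈ S, v i - μ S * m := by
      intro S
      by_cases hS : S.card = k
      · rw [Finset.sum_sub_distrib, Finset.sum_const, hS, nsmul_eq_mul, ← hck]
        ring
      · simp [hμ.2.1 S hS]
    rw [Finset.sum_congr rfl fun S _ => this S, Finset.sum_sub_distrib, ← Finset.sum_mul, hμ.2.2]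
    ring
  have h2 : ∑ S, μ S * ((∑ i ∈ S, (v i - c)) ^ 2 - ∑ i ∈ S, (v i - c) ^ 2) =
      ∑ S, μ S * ((∑ i ∈ S, v i) ^ 2 - ∑ i ∈ S, v i ^ 2) - (2 * m - 2 * c) * m
        + (m ^ 2 - c * m) := by
    have : ∀ S, μ S * ((∑ i ∈ S, (v i - c)) ^ 2 - ∑ i ∈ S, (v i - c) ^ 2) =
        μ S * ((∑ i ∈ S, v i) ^ 2 - ∑ i ∈ S, v i ^ 2) - (2 * m - 2 * c) * (μ S * ∑ i ∈ S, v i)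
          + (m ^ 2 - c * m) * μ S := by
      intro S
      by_cases hS : S.card = k
      · have hsq : ∑ i ∈ S, (v i - c) ^ 2 =
            ∑ i ∈ S, v i ^ 2 - 2 * c * ∑ i ∈ S, v i + k * c ^ 2 := by
          simp only [sub_sq, Finset.sum_add_distrib, Finset.sum_sub_distrib, Finset.sum_const, hS,
            nsmul_eq_mul, Finset.mul_sum]
          congr 2
          exact Finset.sum_congr rfl fun i _ => by ring
        rw [hsq, Finset.sum_sub_distrib, Finset.sum_const, hS, nsmul_eq_mul, ← hck]
        ring
      · simp [hμ.2.1 S hS]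
    rw [Finset.sum_congr rfl fun S _ => this S, Finset.sum_add_distrib, Finset.sum_sub_distrib,
      ← Finset.mul_sum, ← Finset.mul_sum, hμ.2.2, mul_one]
  rw [h1, h2] at h
  have h3 : (1 - 1 / (k : ℝ)) * m ^ 2 = m ^ 2 - c * m := by
    rw [hc]
    ring
  rw [h3]
  linarith

theorem sum_mul_sum_mem {n : ℕ} (μ : Finset (Fin n) → ℝ) (G : Fin n → Finset (Fin n) → ℝ) :
    ∑ S, μ S * ∑ i ∈ S, G i S =
      ∑ i, ∑ S ∈ univ.filter (fun S : Finset (Fin n) => i ∈ S), μ S * G i S := by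
  simp only [Finset.mul_sum]
  exact Finset.sum_comm' (by simp)

theorem sum_mul_sum_eq_sum_marginal {n : ℕ} (μ : Finset (Fin n) → ℝ) (v : Fin n → ℝ) :
    ∑ S, μ S * ∑ i ∈ S, v i = ∑ i, marginal n μ i * v i := by
  rw [sum_mul_sum_mem μ fun i _ => v i]
  exact Finset.sum_congr rfl fun i _ => (Finset.sum_mul _ _ _).symm

theorem sum_mul_sq_sub_eq {n : ℕ} (μ : Finset (Fin n) → ℝ) (v : Fin n → ℝ)
    (hv : ∀ i, v i ≠ 0 → marginal n μ i ≠ 0) :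
    ∑ S, μ S * ((∑ i ∈ S, v i) ^ 2 - ∑ i ∈ S, v i ^ 2) =
      ∑ i, marginal n μ i * v i * ∑ j, marginal n (condDist n μ i) j * v j := by
  have h : ∀ S : Finset (Fin n), (∑ i ∈ S, v i) ^ 2 - ∑ i ∈ S, v i ^ 2 =
      ∑ i ∈ S, v i * ∑ j ∈ S.erase i, v j := by
    intro S
    rw [sq, Finset.sum_mul, ← Finset.sum_sub_distrib]
    refine Finset.sum_congr rfl fun i hi => ?_
    rw [← Finset.add_sum_erase S v hi]
    ring
  simp only [h]
  rw [sum_mul_sum_mem μ fun i S => v i * ∑ j ∈ S.erase i, v j]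
  refine Finset.sum_congr rfl fun i _ => ?_
  by_cases hi : v i = 0
  · simp [hi]
  · rw [← sum_mul_sum_eq_sum_marginal, mul_right_comm, sum_mul_condDist (hv i hi), mul_comm,
      Finset.mul_sum]
    exact Finset.sum_congr rfl fun S _ => by ring

theorem prod_le_sum_div_card_pow {ι : Type*} (s : Finset ι) (hs : s.Nonempty) (z : ι → ℝ)
    (hz : ∀ i ∈ s, 0 ≤ z i) : ∏ i ∈ s, z i ≤ ((∑ i ∈ s, z i) / s.card) ^ s.card := by
  have hc : 0 < s.card := hs.card_pos
  have h := Real.geom_mean_le_arith_mean s (fun _ => 1) z (by simp) (by simpa using hc) hz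
  simp only [Real.rpow_one, Finset.sum_const, nsmul_eq_mul, mul_one, one_mul] at h
  have hp : 0 ≤ ∏ i ∈ s, z i := Finset.prod_nonneg hz
  calc ∏ i ∈ s, z i = ((∏ i ∈ s, z i) ^ ((s.card : ℝ)⁻¹)) ^ s.card :=
        (Real.rpow_inv_natCast_pow hp hc.ne').symm
    _ ≤ _ := pow_le_pow_left₀ (Real.rpow_nonneg hp _) h _

theorem sum_superset_le_marginal {n : ℕ} {μ : Finset (Fin n) → ℝ} (h0 : ∀ S, 0 ≤ μ S)
    {T : Finset (Fin n)} {i : Fin n} (hi : i ∈ T) :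
    ∑ S ∈ univ.filter (fun S : Finset (Fin n) => T ⊆ S), μ S ≤ marginal n μ i := by
  refine Finset.sum_le_sum_of_subset_of_nonneg (fun S hS => ?_) fun S _ _ => h0 S
  simp only [Finset.mem_filter, Finset.mem_univ, true_and] at hS ⊢
  exact hS hi

theorem sum_superset_eq_marginal_mul {n : ℕ} {μ : Finset (Fin n) → ℝ} {T : Finset (Fin n)}
    {i : Fin n} (hi : i ∈ T) (hm : marginal n μ i ≠ 0) :
    ∑ S ∈ univ.filter (fun S : Finset (Fin n) => T ⊆ S), μ S =
      marginal n μ i *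
        ∑ S ∈ univ.filter (fun S : Finset (Fin n) => T.erase i ⊆ S), condDist n μ i S := by
  have h := sum_mul_condDist hm fun S => if T.erase i ⊆ S then 1 else 0
  simp only [mul_ite, mul_one, mul_zero] at h
  rw [Finset.sum_filter (fun S => T.erase i ⊆ S), h, Finset.sum_filter, Finset.sum_filter]
  refine Finset.sum_congr rfl fun S _ => ?_
  by_cases hS : i ∈ S
  · have : T.erase i ⊆ S.erase i ↔ T ⊆ S := by
      rw [← Finset.subset_insert_iff, Finset.insert_erase hS]
    simp [hS, this]
  · have : ¬ T ⊆ S := fun hT => hS (hT hi)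
    simp [hS, this]

/-- Some `i ∈ T` is such that conditioning on `i` does not increase the other marginals of `T`
much on average. -/
theorem exists_sum_condDist_marginal_div_le {n k : ℕ} (hk : 1 ≤ k) {μ : Finset (Fin n) → ℝ}
    (hμ : IsProbDistOn n k μ) (hlc : IsLogConcaveOn n (genPoly n k μ)) {T : Finset (Fin n)}
    (hT : T.Nonempty) (hpos : ∀ i ∈ T, marginal n μ i ≠ 0) :
    ∃ i ∈ T, ∑ j ∈ T.erase i, marginal n (condDist n μ i) j / marginal n μ j ≤
      (1 - 1 / (k : ℝ)) * T.card := by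
  set v : Fin n → ℝ := fun i => if i ∈ T then (marginal n μ i)⁻¹ else 0 with hv
  have hle := sum_mul_sq_sub_le_of_homogeneous hk hμ hlc v
  rw [sum_mul_sq_sub_eq μ v fun i hi => hpos i (by by_contra h; simp [hv, h] at hi),
    sum_mul_sum_eq_sum_marginal] at hle
  have hpv : ∀ i, marginal n μ i * v i = if i ∈ T then 1 else 0 := by
    intro i
    by_cases hi : i ∈ T
    · simp [hv, hi, hpos i hi]
    · simp [hv, hi]
  simp only [hpv, ite_mul, one_mul, zero_mul, Finset.sum_ite_mem, Finset.univ_inter,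
    Finset.sum_const, nsmul_eq_mul, mul_one] at hle
  have hcond : ∀ i, ∑ j, marginal n (condDist n μ i) j * v j =
      ∑ j ∈ T.erase i, marginal n (condDist n μ i) j / marginal n μ j := by
    intro i
    have hself : marginal n (condDist n μ i) i = 0 :=
      Finset.sum_eq_zero fun S hS => if_pos (by simpa using hS)
    simp only [hv, mul_ite, mul_zero, Finset.sum_ite_mem, Finset.univ_inter, ← div_eq_mul_inv]
    exact (Finset.sum_erase T (by rw [hself, zero_div])).symm
  simp only [hcond] at hle
  refine Finset.exists_le_of_sum_le hT (hle.trans_eq ?_)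
  rw [Finset.sum_const, nsmul_eq_mul]
  ring

theorem approximate_negative_correlation
    (n k : ℕ) (hk : 1 ≤ k) (hkn : k ≤ n)
    (μ : Finset (Fin n) → ℝ) (hμ : IsProbDistOn n k μ)
    (hlc : IsLogConcaveOn n (genPoly n k μ))
    (l : ℕ) (hl : 1 ≤ l) (hlk : l ≤ k)
    (T : Finset (Fin n)) (hT : T.card = l) :
    (∑ S ∈ Finset.univ.filter (fun S : Finset (Fin n) => T ⊆ S), μ S)
      ≤ (k.choose l : ℝ) * ((l : ℝ) / (k : ℝ)) ^ l * ∏ i ∈ T, marginal n μ i := by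
  induction l, hl using Nat.le_induction generalizing k μ T with
  | base =>
    obtain ⟨i, rfl⟩ := Finset.card_eq_one.1 hT
    have hk' : (k : ℝ) ≠ 0 := by positivity
    simpa [hk'] using sum_superset_le_marginal hμ.1 (Finset.mem_singleton_self i)
  | succ l hl ih =>
    obtain ⟨k, rfl⟩ : ∃ m, k = m + 1 := ⟨k - 1, by omega⟩
    have hnn : 0 ≤ ∏ i ∈ T, marginal n μ i := Finset.prod_nonneg fun i _ => marginal_nonneg hμ.1 i
    by_cases hpos : ∀ i ∈ T, marginal n μ i ≠ 0
    swap
    · push Not at hpos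
      obtain ⟨i, hi, h0⟩ := hpos
      exact (sum_superset_le_marginal hμ.1 hi).trans (h0.le.trans (by positivity))
    obtain ⟨i, hi, hsum⟩ := exists_sum_condDist_marginal_div_le hk hμ hlc
      (Finset.card_pos.1 (by omega)) hpos
    have hc := isProbDistOn_condDist hμ (hpos i hi)
    have hcard : (T.erase i).card = l := by rw [Finset.card_erase_of_mem hi, hT]; rfl
    have hih := ih k (by omega) (by omega) (condDist n μ i) hc
      (isLogConcaveOn_condDist hμ hlc (hpos i hi)) (by omega) (T.erase i) hcard
    have hl0 : (0 : ℝ) < l := by exact_mod_cast hl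
    have hk0 : (0 : ℝ) < k := by exact_mod_cast (by omega : 0 < k)
    have hratio : ∀ j ∈ T.erase i, 0 ≤ marginal n (condDist n μ i) j / marginal n μ j :=
      fun j _ => div_nonneg (marginal_nonneg hc.1 j) (marginal_nonneg hμ.1 j)
    have hamgm := prod_le_sum_div_card_pow (T.erase i) (Finset.card_pos.1 (by omega)) _ hratio
    rw [hcard] at hamgm
    rw [hT] at hsum
    have hprod : ∏ j ∈ T.erase i, marginal n (condDist n μ i) j ≤
        ((k : ℝ) / (k + 1) * (l + 1) / l) ^ l * ∏ j ∈ T.erase i, marginal n μ j := by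
      have hpp : 0 < ∏ j ∈ T.erase i, marginal n μ j := Finset.prod_pos fun j hj =>
        (marginal_nonneg hμ.1 j).lt_of_ne' (hpos j (Finset.mem_of_mem_erase hj))
      rw [← div_le_iff₀ hpp, ← Finset.prod_div_distrib]
      refine hamgm.trans (pow_le_pow_left₀ (div_nonneg (Finset.sum_nonneg hratio) hl0.le) ?_ _)
      refine div_le_div_of_nonneg_right (hsum.trans_eq ?_) hl0.le
      push_cast
      field_simp
      ring
    have hchoose : ((k + 1).choose (l + 1) : ℝ) * (l + 1) = (k + 1) * k.choose l := by
      exact_mod_cast (Nat.add_one_mul_choose_eq k l).symm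
    rw [sum_superset_eq_marginal_mul hi (hpos i hi)]
    calc _ ≤ marginal n μ i * ((k.choose l : ℝ) * ((l : ℝ) / k) ^ l *
          (((k : ℝ) / (k + 1) * (l + 1) / l) ^ l * ∏ j ∈ T.erase i, marginal n μ j)) := by
          refine mul_le_mul_of_nonneg_left (hih.trans ?_) (marginal_nonneg hμ.1 i)
          exact mul_le_mul_of_nonneg_left hprod (by positivity)
      _ = _ := by
          rw [← Finset.mul_prod_erase T _ hi]
          have hpow : ((l : ℝ) / k) ^ l * ((k : ℝ) / (k + 1) * (l + 1) / l) ^ l =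
              (((l : ℝ) + 1) / (k + 1)) ^ l := by
            rw [← mul_pow]
            congr 1
            field_simp
          have hcoef : ((k + 1).choose (l + 1) : ℝ) * (((l : ℝ) + 1) / (k + 1)) = k.choose l := by
            rw [← mul_div_assoc, hchoose]
            field_simp
          push_cast
          rw [pow_succ]
          set P := ∏ j ∈ T.erase i, marginal n μ j
          linear_combination marginal n μ i * P * k.choose l * hpow -
            marginal n μ i * P * (((l : ℝ) + 1) / (k + 1)) ^ l * hcoef
end

section
/- Let μ be a probability distribution on the k-element subsets of [n] whose generating polynomial g_μ is log-concave, let p be a probability distribution on [n] with p(i) > 0 for all i, and let t ≥ 1 be an integer. Then μ is a stationary distribution of the Markov chain M_{μ,p}^t: for every k-element subset S₁ ⊆ [n], ∑_{S₀ ∈ binom([n],k)} μ(S₀) · P(S₀, S₁) = μ(S₁), where P is the transition kernel of M_{μ,p}^t. -/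
open Finset

open scoped Classical

/-- The weight `w(τ,S) = μ(τ_S) · ∏_{i∈S} p(τ_i)⁻¹` for a sequence `τ ∈ [n]^r`
and an index set `S ⊆ [r]`. -/
noncomputable def wSeq (n r : ℕ) (μ : Finset (Fin n) → ℝ) (p : Fin n → ℝ)
    (τ : Fin r → Fin n) (S : Finset (Fin r)) : ℝ :=
  μ (S.image τ) * ∏ i ∈ S, (p (τ i))⁻¹

/-- The normalization constant `Z_{μ,p}(τ) = ∑_{S ∈ binom([r],k)} w(τ,S)`. -/
noncomputable def Zconst (n k r : ℕ) (μ : Finset (Fin n) → ℝ) (p : Fin n → ℝ)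
    (τ : Fin r → Fin n) : ℝ :=
  ∑ S ∈ Finset.univ.filter (fun S : Finset (Fin r) => S.card = k), wSeq n r μ p τ S

/-- The distribution `μ_{τ,p}(S) = w(τ,S)/Z_{μ,p}(τ)`, with value `0` when `Z = 0`. -/
noncomputable def muTau (n k r : ℕ) (μ : Finset (Fin n) → ℝ) (p : Fin n → ℝ)
    (τ : Fin r → Fin n) (S : Finset (Fin r)) : ℝ :=
  if Zconst n k r μ p τ = 0 then 0 else wSeq n r μ p τ S / Zconst n k r μ p τ

/-- The interleaving distribution `q_{S₀}` on `[n]^r`: draw `t = r - k` i.i.d. samples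
from `p` and permute the elements of `S₀` into the sequence uniformly at random. -/
noncomputable def interDist (n k r : ℕ) (p : Fin n → ℝ) (S₀ : Finset (Fin n))
    (τ : Fin r → Fin n) : ℝ :=
  (1 / ((Nat.factorial k : ℝ) * (r.choose k : ℝ))) *
    ∑ A ∈ Finset.univ.filter (fun A : Finset (Fin r) => A.card = k),
      ∑ b : {x // x ∈ A} → {y // y ∈ S₀},
        if Function.Bijective b ∧ ∀ i : {x // x ∈ A}, τ i.1 = (b i).1 then
          ∏ i ∈ Finset.univ \ A, p (τ i)
        else 0

/-- The transition kernel `P(S₀, S₁)` of the Markov chain `M_{μ,p}^t`, with `r = t + k`. -/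
noncomputable def kernel (n k t : ℕ) (μ : Finset (Fin n) → ℝ) (p : Fin n → ℝ)
    (S₀ S₁ : Finset (Fin n)) : ℝ :=
  ∑ τ : Fin (t + k) → Fin n,
    interDist n k (t + k) p S₀ τ *
      ∑ S ∈ Finset.univ.filter
          (fun S : Finset (Fin (t + k)) => S.card = k ∧ S.image τ = S₁),
        muTau n k (t + k) μ p τ S

/-- For `A` and `S` of equal size, the only bijection `A → S` that `τ` can agree with on `A`
is its own restriction, which exists exactly when `τ` maps `A` onto `S`. -/
lemma sum_bijective_agree_eq_ite {n r : ℕ} (τ : Fin r → Fin n) (A : Finset (Fin r))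
    (S : Finset (Fin n)) (h : A.card = S.card) (X : ℝ) :
    (∑ b : {x // x ∈ A} → {y // y ∈ S},
      if Function.Bijective b ∧ ∀ i : {x // x ∈ A}, τ i.1 = (b i).1 then X else 0) =
      if A.image τ = S then X else 0 := by
  split_ifs with himg
  · have hmem : ∀ i : {x // x ∈ A}, τ i.1 ∈ S := fun i => himg ▸ mem_image_of_mem τ i.2
    set b₀ : {x // x ∈ A} → {y // y ∈ S} := fun i => ⟨τ i.1, hmem i⟩ with hb₀
    have hsurj : Function.Surjective b₀ := by
      rintro ⟨y, hy⟩
      rw [← himg, mem_image] at hy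
      obtain ⟨x, hx, rfl⟩ := hy
      exact ⟨⟨x, hx⟩, rfl⟩
    have hbij : Function.Bijective b₀ :=
      (Fintype.bijective_iff_surjective_and_card b₀).2 ⟨hsurj, by simpa using h⟩
    rw [Fintype.sum_eq_single b₀]
    · rw [if_pos ⟨hbij, fun i => rfl⟩]
    · intro b hb
      refine if_neg fun hc => hb ?_
      funext i
      exact Subtype.ext (hc.2 i).symm
  · refine sum_eq_zero fun b _ => if_neg fun hc => himg ?_
    ext y
    rw [mem_image]
    constructor
    · rintro ⟨x, hx, rfl⟩
      rw [hc.2 ⟨x, hx⟩]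
      exact (b ⟨x, hx⟩).2
    · intro hy
      obtain ⟨x, hx⟩ := hc.1.2 ⟨y, hy⟩
      exact ⟨x.1, x.2, by rw [hc.2 x, hx]⟩

lemma sum_prod_compl_of_agree {n r : ℕ} (p : Fin n → ℝ) (hp1 : ∑ i : Fin n, p i = 1)
    (A : Finset (Fin r)) (S : Finset (Fin n)) (b : {x // x ∈ A} → {y // y ∈ S}) :
    (∑ τ : Fin r → Fin n,
      if ∀ i : {x // x ∈ A}, τ i.1 = (b i).1 then ∏ i ∈ univ \ A, p (τ i) else 0) = 1 := by
  have hfactor : ∀ τ : Fin r → Fin n,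
      (if ∀ i : {x // x ∈ A}, τ i.1 = (b i).1 then ∏ i ∈ univ \ A, p (τ i) else 0) =
      ∏ i, if hi : i ∈ A then (if τ i = (b ⟨i, hi⟩).1 then 1 else 0) else p (τ i) := by
    intro τ
    rw [← prod_sdiff (subset_univ A)]
    have hcompl : (∏ i ∈ univ \ A,
        if hi : i ∈ A then (if τ i = (b ⟨i, hi⟩).1 then (1 : ℝ) else 0) else p (τ i)) =
        ∏ i ∈ univ \ A, p (τ i) :=
      prod_congr rfl fun i hi => dif_neg (mem_sdiff.1 hi).2
    rw [hcompl]
    split_ifs with hc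
    · rw [prod_eq_one (s := A), mul_one]
      intro i hi
      rw [dif_pos hi, if_pos (hc ⟨i, hi⟩)]
    · push Not at hc
      obtain ⟨i, hi⟩ := hc
      rw [prod_eq_zero i.2, mul_zero]
      rw [dif_pos i.2, if_neg hi]
  simp_rw [hfactor]
  have hswap := Fintype.prod_sum (fun (i : Fin r) (x : Fin n) =>
    if hi : i ∈ A then (if x = (b ⟨i, hi⟩).1 then (1 : ℝ) else 0) else p x)
  rw [← hswap]
  refine prod_eq_one fun i _ => ?_
  by_cases hi : i ∈ A
  · simp [hi]
  · simp [hi, hp1]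

lemma sum_prod_compl_of_image_eq {n r k : ℕ} (p : Fin n → ℝ) (hp1 : ∑ i : Fin n, p i = 1)
    (A : Finset (Fin r)) (S : Finset (Fin n)) (hA : A.card = k) (hS : S.card = k) :
    (∑ τ : Fin r → Fin n, if A.image τ = S then ∏ i ∈ univ \ A, p (τ i) else 0) =
      (k.factorial : ℝ) := by
  simp_rw [← sum_bijective_agree_eq_ite _ A S (hA.trans hS.symm)]
  rw [sum_comm]
  have hinner : ∀ b : {x // x ∈ A} → {y // y ∈ S},
      (∑ τ : Fin r → Fin n,
        if Function.Bijective b ∧ ∀ i : {x // x ∈ A}, τ i.1 = (b i).1 then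
          ∏ i ∈ univ \ A, p (τ i) else 0) = if Function.Bijective b then 1 else 0 := by
    intro b
    split_ifs with hb
    · simp only [hb, true_and]
      exact sum_prod_compl_of_agree p hp1 A S b
    · exact sum_eq_zero fun τ _ => if_neg fun hc => hb hc.1
  simp_rw [hinner]
  rw [sum_boole, ← Fintype.card_subtype,
    Fintype.card_congr (Equiv.ofBijective
      (fun e : {x // x ∈ A} ≃ {y // y ∈ S} =>
        (⟨e, e.bijective⟩ : {b : {x // x ∈ A} → {y // y ∈ S} // Function.Bijective b}))
      ⟨fun e f h => Equiv.coe_fn_injective (Subtype.ext_iff.1 h),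
        fun b => ⟨Equiv.ofBijective b.1 b.2, rfl⟩⟩).symm,
    Fintype.card_equiv (Fintype.equivOfCardEq (by simp [hA, hS]))]
  simp [hA]

lemma interDist_eq {n k r : ℕ} (p : Fin n → ℝ) (S₀ : Finset (Fin n)) (hS₀ : S₀.card = k)
    (τ : Fin r → Fin n) :
    interDist n k r p S₀ τ = (1 / ((k.factorial : ℝ) * (r.choose k : ℝ))) *
      ∑ A ∈ univ.filter (fun A : Finset (Fin r) => A.card = k),
        if A.image τ = S₀ then ∏ i ∈ univ \ A, p (τ i) else 0 := by
  unfold interDist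
  congr 1
  refine sum_congr rfl fun A hA => ?_
  exact sum_bijective_agree_eq_ite τ A S₀ ((mem_filter.1 hA).2.trans hS₀.symm) _

lemma prod_mul_wSeq {n r : ℕ} (μ : Finset (Fin n) → ℝ) (p : Fin n → ℝ) (hp : ∀ i, 0 < p i)
    (τ : Fin r → Fin n) (A : Finset (Fin r)) :
    (∏ i, p (τ i)) * wSeq n r μ p τ A = μ (A.image τ) * ∏ i ∈ univ \ A, p (τ i) := by
  have hne : ∏ i ∈ A, p (τ i) ≠ 0 := prod_ne_zero_iff.2 fun i _ => (hp _).ne'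
  unfold wSeq
  rw [← prod_sdiff (subset_univ A), prod_inv_distrib]
  field_simp

/-- The law of the interleaved sequence, when the starting set is drawn from `μ`, has density
proportional to `Z_{μ,p}` with respect to i.i.d. samples from `p`. -/
lemma sum_mul_interDist {n k r : ℕ} (μ : Finset (Fin n) → ℝ) (hμ : IsProbDistOn n k μ)
    (p : Fin n → ℝ) (hp : ∀ i, 0 < p i) (τ : Fin r → Fin n) :
    (∑ S₀ ∈ univ.filter (fun S : Finset (Fin n) => S.card = k),
      μ S₀ * interDist n k r p S₀ τ) =
      (1 / ((k.factorial : ℝ) * (r.choose k : ℝ))) *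
        ((∏ i, p (τ i)) * Zconst n k r μ p τ) := by
  have hstep : ∀ S₀ ∈ univ.filter (fun S : Finset (Fin n) => S.card = k),
      μ S₀ * interDist n k r p S₀ τ = (1 / ((k.factorial : ℝ) * (r.choose k : ℝ))) *
        ∑ A ∈ univ.filter (fun A : Finset (Fin r) => A.card = k),
          if A.image τ = S₀ then μ S₀ * ∏ i ∈ univ \ A, p (τ i) else 0 := by
    intro S₀ hS₀
    rw [interDist_eq p S₀ (mem_filter.1 hS₀).2, mul_left_comm, mul_sum]
    simp_rw [mul_ite, mul_zero]
  rw [sum_congr rfl hstep, ← mul_sum, sum_comm, Zconst, mul_sum _ _ (∏ i, p (τ i))]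
  congr 1
  refine sum_congr rfl fun A _ => ?_
  rw [prod_mul_wSeq μ p hp, sum_ite_eq]
  split_ifs with hmem
  · rfl
  · rw [hμ.2.1 (A.image τ) (by simpa using hmem), zero_mul]

lemma Zconst_mul_muTau {n k r : ℕ} (μ : Finset (Fin n) → ℝ) (hμ : ∀ S, 0 ≤ μ S)
    (p : Fin n → ℝ) (hp : ∀ i, 0 < p i) (τ : Fin r → Fin n) (S : Finset (Fin r))
    (hS : S.card = k) :
    Zconst n k r μ p τ * muTau n k r μ p τ S = wSeq n r μ p τ S := by
  unfold muTau
  split_ifs with hZ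
  · rw [mul_zero]
    have hnonneg : ∀ A ∈ univ.filter (fun A : Finset (Fin r) => A.card = k),
        0 ≤ wSeq n r μ p τ A := fun A _ =>
      mul_nonneg (hμ _) (prod_nonneg fun i _ => (inv_pos.2 (hp _)).le)
    exact ((sum_eq_zero_iff_of_nonneg hnonneg).1 hZ S (by simpa using hS)).symm
  · field_simp

theorem stationary_distribution
    (n k t : ℕ) (hk : 1 ≤ k) (hkn : k ≤ n) (ht : 1 ≤ t)
    (μ : Finset (Fin n) → ℝ) (hμ : IsProbDistOn n k μ)
    (hlc : IsLogConcaveOn n (genPoly n k μ))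
    (p : Fin n → ℝ) (hp : ∀ i, 0 < p i) (hp1 : ∑ i : Fin n, p i = 1)
    (S₁ : Finset (Fin n)) (hS₁ : S₁.card = k) :
    (∑ S₀ ∈ Finset.univ.filter (fun S : Finset (Fin n) => S.card = k),
        μ S₀ * kernel n k t μ p S₀ S₁) = μ S₁ := by
  have hcond : ∀ τ : Fin (t + k) → Fin n,
      ((∏ i, p (τ i)) * Zconst n k (t + k) μ p τ) *
        (∑ S ∈ Finset.univ.filter
          (fun S : Finset (Fin (t + k)) => S.card = k ∧ S.image τ = S₁),
          muTau n k (t + k) μ p τ S) =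
      ∑ S ∈ univ.filter (fun S : Finset (Fin (t + k)) => S.card = k),
        μ S₁ * if S.image τ = S₁ then ∏ i ∈ univ \ S, p (τ i) else 0 := by
    intro τ
    rw [mul_sum, ← filter_filter, sum_filter (fun S : Finset (Fin (t + k)) => S.image τ = S₁)]
    refine sum_congr rfl fun S hS => ?_
    split_ifs with himg
    · rw [mul_assoc, Zconst_mul_muTau μ hμ.1 p hp τ S (mem_filter.1 hS).2,
        prod_mul_wSeq μ p hp, himg]
    · rw [mul_zero]
  have hcard : (univ.filter (fun S : Finset (Fin (t + k)) => S.card = k)).card =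
      (t + k).choose k := by
    simp
  have hfact : (k.factorial : ℝ) ≠ 0 := Nat.cast_ne_zero.2 k.factorial_ne_zero
  have hchoose : ((t + k).choose k : ℝ) ≠ 0 :=
    Nat.cast_ne_zero.2 (Nat.choose_pos (Nat.le_add_left k t)).ne'
  simp only [kernel, mul_sum _ _ (μ _)]
  rw [sum_comm]
  simp_rw [← mul_assoc, ← sum_mul, sum_mul_interDist μ hμ p hp, mul_assoc]
  rw [← mul_sum]
  simp_rw [← mul_assoc, hcond]
  rw [sum_comm]
  simp_rw [← mul_sum]
  rw [sum_congr rfl fun S hS =>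
    sum_prod_compl_of_image_eq p hp1 S S₁ (mem_filter.1 hS).2 hS₁]
  rw [sum_const, hcard, nsmul_eq_mul]
  field_simp
end

section
/- Let μ be a probability distribution on the k-element subsets of [n] and let p be a probability distribution on [n] with p(i) > 0 for all i. For any r ≥ k and every sequence τ ∈ [n]^r, the μ-mixture of the interleaving distributions satisfies ∑_{S₀ ∈ binom([n],k)} μ(S₀) · q_{S₀}(τ) = (∏_{i=1}^r p(τ_i)) · Z_{μ,p}(τ) / (k! · binom(r,k)). -/
open Finset

open scoped Classical

/-- Two finsets of equal size admit exactly one bijection `A → S` that agrees with `τ` if `S` is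
the image of `A` under `τ`, and none otherwise. -/
theorem sum_bijective_agreeing {α β R : Type*} [DecidableEq α] [DecidableEq β] [AddCommMonoid R]
    (τ : α → β) (A : Finset α) (S : Finset β) (h : A.card = S.card) (c : R) :
    (∑ b : {x // x ∈ A} → {y // y ∈ S},
        if Function.Bijective b ∧ ∀ i : {x // x ∈ A}, τ i.1 = (b i).1 then c else 0)
      = if S = A.image τ then c else 0 := by
  split_ifs with hS
  · subst hS
    have hinj : Set.InjOn τ A := Finset.card_image_iff.mp h.symm
    rw [Finset.sum_eq_single
      (fun i : {x // x ∈ A} => (⟨τ i.1, Finset.mem_image_of_mem τ i.2⟩ : {y // y ∈ A.image τ}))]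
    · refine if_pos ⟨⟨fun x y hxy => ?_, fun ⟨y, hy⟩ => ?_⟩, fun _ => rfl⟩
      · exact Subtype.ext (hinj x.2 y.2 (congrArg Subtype.val hxy))
      · obtain ⟨x, hx, rfl⟩ := Finset.mem_image.mp hy
        exact ⟨⟨x, hx⟩, rfl⟩
    · intro b _ hb
      exact if_neg fun hb' => hb (funext fun i => Subtype.ext (hb'.2 i).symm)
    · exact fun hb => absurd (Finset.mem_univ _) hb
  · refine Finset.sum_eq_zero fun b _ => if_neg ?_
    rintro ⟨hb, hτ⟩
    refine hS (Finset.ext fun y => ?_)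
    rw [Finset.mem_image]
    constructor
    · intro hy
      obtain ⟨x, hx⟩ := hb.surjective ⟨y, hy⟩
      exact ⟨x.1, x.2, by rw [hτ x, hx]⟩
    · rintro ⟨x, hx, rfl⟩
      rw [hτ ⟨x, hx⟩]
      exact (b ⟨x, hx⟩).2

theorem mixture_of_interleavings
    (n k r : ℕ) (hk : 1 ≤ k) (hkn : k ≤ n) (hr : k ≤ r)
    (μ : Finset (Fin n) → ℝ) (hμ : IsProbDistOn n k μ)
    (p : Fin n → ℝ) (hp : ∀ i, 0 < p i) (hp1 : ∑ i : Fin n, p i = 1)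
    (τ : Fin r → Fin n) :
    (∑ S₀ ∈ Finset.univ.filter (fun S : Finset (Fin n) => S.card = k),
        μ S₀ * interDist n k r p S₀ τ)
      = (∏ i : Fin r, p (τ i)) * Zconst n k r μ p τ
          / ((Nat.factorial k : ℝ) * (r.choose k : ℝ)) := by
  have hinter : ∀ S₀ ∈ Finset.univ.filter (fun S : Finset (Fin n) => S.card = k),
      μ S₀ * interDist n k r p S₀ τ
        = ∑ A ∈ Finset.univ.filter (fun A : Finset (Fin r) => A.card = k),
          if S₀ = A.image τ then
            (1 / ((Nat.factorial k : ℝ) * (r.choose k : ℝ))) *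
              (μ (A.image τ) * ∏ i ∈ Finset.univ \ A, p (τ i))
          else 0 := by
    intro S₀ hS₀
    rw [interDist, mul_left_comm, Finset.mul_sum, Finset.mul_sum]
    refine Finset.sum_congr rfl fun A hA => ?_
    rw [sum_bijective_agreeing τ A S₀
      ((Finset.mem_filter.mp hA).2.trans (Finset.mem_filter.mp hS₀).2.symm)]
    split_ifs with h
    · rw [h]
    · simp
  rw [Finset.sum_congr rfl hinter, Finset.sum_comm, Zconst, Finset.mul_sum, Finset.sum_div]
  refine Finset.sum_congr rfl fun A _ => ?_
  have hprod : (∏ i : Fin r, p (τ i)) * ∏ i ∈ A, (p (τ i))⁻¹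
      = ∏ i ∈ Finset.univ \ A, p (τ i) := by
    rw [← Finset.prod_sdiff (Finset.subset_univ A), mul_assoc, ← Finset.prod_mul_distrib,
      Finset.prod_congr rfl fun i _ => mul_inv_cancel₀ (hp (τ i)).ne', Finset.prod_const_one,
      mul_one]
  rw [Finset.sum_ite_eq', wSeq, ← hprod]
  split_ifs with h
  · ring
  · rw [hμ.2.1 _ fun hc => h (Finset.mem_filter.mpr ⟨Finset.mem_univ _, hc⟩)]
    simp
end
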